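/- Δ(ε) ≤ (96/121) ε² for all 0 < ε ≤ 11/16. -/

import Mathlib

open MeasureTheory

/-- A set `C ⊆ ℝ` is symmetric if there is a center `c` with `c + x ∈ C ↔ c - x ∈ C`. -/
def IsSymmetricSet (C : Set ℝ) : Prop := ∃ c : ℝ, ∀ x : ℝ, c + x ∈ C ↔ c - x ∈ C

/-- `DD A` is the supremum of measures of measurable symmetric subsets of `A`. -/
noncomputable def DD (A : Set ℝ) : ℝ :=
  sSup {m : ℝ | ∃ C : Set ℝ, C ⊆ A ∧ MeasurableSet C ∧ IsSymmetricSet C ∧ m = (volume C).toReal}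

/-- `Δ ε` is the infimum of `DD A` over measurable `A ⊆ [0,1)` with measure `ε`. -/
noncomputable def Δ (ε : ℝ) : ℝ :=
  sInf {d : ℝ | ∃ A : Set ℝ, A ⊆ Set.Ico (0:ℝ) 1 ∧ MeasurableSet A ∧
    volume A = ENNReal.ofReal ε ∧ d = DD A}

open Finset

/-- The union of the cells `[i / N, (i + 1) / N)` with `i ∈ T`. -/
def cellUnion (N : ℕ) (T : Finset ℤ) : Set ℝ := {x | ⌊N * x⌋ ∈ T}

lemma measurableSet_cellUnion (N : ℕ) (T : Finset ℤ) : MeasurableSet (cellUnion N T) :=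
  (Int.measurable_floor.comp (measurable_const_mul (N : ℝ))) T.measurableSet

lemma floor_mul_eq_iff {N : ℕ} (hN : 0 < N) (x : ℝ) (i : ℤ) :
    ⌊N * x⌋ = i ↔ x ∈ Set.Ico (i / N : ℝ) (i / N + 1 / N) := by
  have : (0 : ℝ) < N := by exact_mod_cast hN
  rw [Int.floor_eq_iff, Set.mem_Ico, ← add_div, div_le_iff₀' this, lt_div_iff₀' this]

lemma volume_inter_cellUnion {N : ℕ} (hN : 0 < N) (T : Finset ℤ) {C : Set ℝ}
    (hC : MeasurableSet C) :
    volume (C ∩ cellUnion N T) =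
      ∫⁻ u in Set.Ico (0 : ℝ) (1 / N), ∑ i ∈ T, C.indicator 1 (u + (i / N : ℝ)) := by
  classical
  have h : C ∩ cellUnion N T = ⋃ i ∈ T, C ∩ Set.Ico (i / N : ℝ) (i / N + 1 / N) := by
    ext x
    simp only [cellUnion, Set.mem_inter_iff, Set.mem_ofPred_eq, Set.mem_iUnion,
      ← floor_mul_eq_iff hN]
    grind
  have hm : ∀ i : ℤ, Measurable fun u : ℝ => C.indicator (1 : ℝ → ENNReal) (u + (i / N : ℝ)) :=
    fun i => (measurable_one.indicator hC).comp (measurable_add_const _)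
  rw [h, measure_biUnion_finset, lintegral_finsetSum _ fun i _ => hm i]
  · refine sum_congr rfl fun i _ => ?_
    rw [← lintegral_indicator measurableSet_Ico, ← lintegral_indicator_one
      (hC.inter measurableSet_Ico), ← lintegral_add_right_eq_self _ (i / N : ℝ)]
    refine lintegral_congr fun u => ?_
    by_cases h1 : u ∈ Set.Ico (0 : ℝ) (1 / N)
    · have : u + i / N ∈ Set.Ico (i / N : ℝ) (i / N + 1 / N) := by
        constructor <;> linarith [h1.1, h1.2]
      rw [Set.indicator_of_mem h1]
      simp only [Set.indicator_apply, Set.mem_inter_iff, this, and_true]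
    · have : u + i / N ∉ Set.Ico (i / N : ℝ) (i / N + 1 / N) := by
        intro h; apply h1; constructor <;> linarith [h.1, h.2]
      rw [Set.indicator_of_notMem h1]
      simp only [Set.indicator_apply, Set.mem_inter_iff, this, and_false, if_false]
  · intro i _ j _ hij
    refine Set.disjoint_left.2 fun x hx hx' => hij ?_
    rw [← (floor_mul_eq_iff hN x i).2 hx.2, ← (floor_mul_eq_iff hN x j).2 hx'.2]
  · exact fun i _ => hC.inter measurableSet_Ico

lemma volume_cellUnion {N : ℕ} (hN : 0 < N) (T : Finset ℤ) :
    volume (cellUnion N T) = ENNReal.ofReal (T.card / N) := by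
  have h := volume_inter_cellUnion hN T MeasurableSet.univ
  rw [Set.univ_inter] at h
  rw [h]
  simp only [Set.indicator_univ, Pi.one_apply, sum_const, nsmul_eq_mul, mul_one,
    setLIntegral_const, Real.volume_Ico, sub_zero]
  rw [div_eq_mul_one_div (T.card : ℝ), ENNReal.ofReal_mul (by positivity), ENNReal.ofReal_natCast]

lemma DD_le_of_subset_cellUnion {N M : ℕ} (hN : 0 < N) {T : Finset ℤ}
    (hM : ∀ k : ℤ, (T.filter fun x => k - x ∈ T).card ≤ M) {A : Set ℝ}
    (hA : A ⊆ cellUnion N T) : DD A ≤ M / N := by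
  classical
  have hN' : (N : ℝ) ≠ 0 := by exact_mod_cast hN.ne'
  refine Real.sSup_le ?_ (by positivity)
  rintro _ ⟨C, hCA, hC, ⟨c, hc⟩, rfl⟩
  refine ENNReal.toReal_le_of_le_ofReal (by positivity) ?_
  rw [← Set.inter_eq_left.2 (hCA.trans hA), volume_inter_cellUnion hN T hC]
  calc _ ≤ ∫⁻ u in Set.Ico (0 : ℝ) (1 / N), (M : ENNReal) := by
        refine lintegral_mono fun u => ?_
        simp only [Set.indicator_apply, Pi.one_apply]
        rw [sum_boole]
        refine Nat.cast_le.2 ((card_le_card ?_).trans (hM ⌊N * (2 * c - u)⌋))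
        intro i hi
        rw [mem_filter] at hi ⊢
        refine ⟨hi.1, ?_⟩
        have h1 : 2 * c - (u + i / N) ∈ C := by
          have := (hc (u + i / N - c)).1 (by simpa using hi.2)
          convert this using 1
          ring
        have h2 : ⌊N * (2 * c - (u + i / N))⌋ ∈ T := hA (hCA h1)
        have h3 : N * (2 * c - (u + i / N)) = N * (2 * c - u) - i := by field_simp; ring
        rwa [h3, Int.floor_sub_intCast] at h2
    _ = _ := by
        simp only [setLIntegral_const, Real.volume_Ico, sub_zero]
        rw [div_eq_mul_one_div (M : ℝ), ENNReal.ofReal_mul (by positivity),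
          ENNReal.ofReal_natCast]

lemma exists_subset_volume_eq {A : Set ℝ} (hA : MeasurableSet A) (hA1 : A ⊆ Set.Ico 0 1)
    {ε : ℝ} (hε : 0 ≤ ε) (h : ENNReal.ofReal ε ≤ volume A) :
    ∃ B ⊆ A, MeasurableSet B ∧ volume B = ENNReal.ofReal ε := by
  have hfin : volume A ≠ ⊤ := measure_ne_top_of_subset hA1 (by simp)
  set g : ℝ → ℝ := fun s => volume.real (A ∩ Set.Iio s) with hg
  have hg_fin : ∀ s, volume (A ∩ Set.Iio s) ≠ ⊤ := fun s =>
    measure_ne_top_of_subset Set.inter_subset_left hfin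
  have hlip : LipschitzWith 1 g := by
    refine LipschitzWith.of_le_add_mul 1 fun s t => ?_
    have h1 : A ∩ Set.Iio s ⊆ (A ∩ Set.Iio t) ∪ Set.Ico t s := by
      rintro x ⟨hx, hxs⟩
      by_cases hxt : x < t
      · exact Or.inl ⟨hx, hxt⟩
      · exact Or.inr ⟨not_lt.1 hxt, hxs⟩
    have h2 : g s ≤ g t + volume.real (Set.Ico t s) :=
      (measureReal_mono h1 (measure_union_lt_top (hg_fin t).lt_top (by simp)).ne).trans
        (measureReal_union_le _ _)
    have h3 : volume.real (Set.Ico t s) ≤ dist s t := by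
      rw [Real.volume_real_Ico, Real.dist_eq]
      exact max_le (le_abs_self _) (abs_nonneg _)
    simp only [NNReal.coe_one, one_mul]
    linarith
  have h0 : g 0 = 0 := by
    have : A ∩ Set.Iio 0 = ∅ := by
      ext x
      simp only [Set.mem_inter_iff, Set.mem_Iio, Set.mem_empty_iff_false, iff_false, not_and,
        not_lt]
      exact fun hx => (hA1 hx).1
    simp [hg, this]
  have h1 : g 1 = volume.real A := by
    have : A ∩ Set.Iio 1 = A := Set.inter_eq_left.2 fun x hx => (hA1 hx).2
    simp [hg, this]
  obtain ⟨s, -, hs⟩ := intermediate_value_Icc zero_le_one hlip.continuous.continuousOn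
    (show ε ∈ Set.Icc (g 0) (g 1) from
      by
      rw [h0, h1]
      exact ⟨hε, (ENNReal.ofReal_le_iff_le_toReal hfin).1 h⟩)
  refine ⟨A ∩ Set.Iio s, Set.inter_subset_left, hA.inter measurableSet_Iio, ?_⟩
  rw [← hs]
  exact (ENNReal.ofReal_toReal (hg_fin s)).symm

lemma DD_nonneg (A : Set ℝ) : 0 ≤ DD A := by
  refine Real.sSup_nonneg ?_
  rintro _ ⟨C, -, -, -, rfl⟩
  exact ENNReal.toReal_nonneg

lemma Δ_le_of_finset {N M : ℕ} (hN : 0 < N) {T : Finset ℤ} (hT : ∀ x ∈ T, 0 ≤ x ∧ x < N)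
    (hM : ∀ k : ℤ, (T.filter fun x => k - x ∈ T).card ≤ M) {ε : ℝ} (hε : 0 ≤ ε)
    (hcard : ε * N ≤ T.card) : Δ ε ≤ M / N := by
  have hN' : (0 : ℝ) < N := by exact_mod_cast hN
  have hA1 : cellUnion N T ⊆ Set.Ico 0 1 := by
    intro x hx
    obtain ⟨h0, h1⟩ := hT _ hx
    have h0' : 0 ≤ (N : ℝ) * x := Int.floor_nonneg.1 h0
    have h1' : (N : ℝ) * x < N := by simpa using Int.floor_lt.1 h1
    constructor <;> nlinarith
  obtain ⟨B, hBA, hB, hBε⟩ := exists_subset_volume_eq (measurableSet_cellUnion N T) hA1 hε (by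
    rw [volume_cellUnion hN]
    exact ENNReal.ofReal_le_ofReal ((le_div_iff₀ hN').2 hcard))
  refine le_trans ?_ (DD_le_of_subset_cellUnion hN hM hBA)
  refine csInf_le ⟨0, ?_⟩ ⟨B, hBA.trans hA1, hB, hBε, rfl⟩
  rintro _ ⟨A, -, -, -, rfl⟩
  exact DD_nonneg A

section Combinatorics

variable {p : ℕ}

lemma int_eq_of_zmod_eq_of_div_eq [NeZero p] {x y : ℤ} (h : (x : ZMod p) = y)
    (hd : x / p = y / p) : x = y := by
  have h' : x % p = y % p := (ZMod.intCast_eq_intCast_iff' _ _ _).1 h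
  rw [← Int.mul_ediv_add_emod x p, ← Int.mul_ediv_add_emod y p, h', hd]

lemma ediv_sub_cases (P k x : ℤ) (hP : 0 < P) :
    (k - x) / P = k / P - x / P ∨ (k - x) / P = k / P - x / P - 1 := by
  have h1 := Int.mul_ediv_add_emod k P
  have h2 := Int.mul_ediv_add_emod x P
  have h3 := Int.emod_nonneg k hP.ne'
  have h4 := Int.emod_nonneg x hP.ne'
  have h5 := Int.emod_lt_of_pos k hP
  have h6 := Int.emod_lt_of_pos x hP
  rcases le_or_gt (x % P) (k % P) with h | h
  · left
    rw [Int.ediv_eq_iff_of_pos hP]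
    constructor <;> linarith
  · right
    rw [Int.ediv_eq_iff_of_pos hP]
    constructor <;> linarith

lemma ediv_sub_eq_val [NeZero p] (k x : ℤ) :
    (k - x) / p = (k - (x : ZMod p).val) / p - x / p := by
  have hp : (p : ℤ) ≠ 0 := by exact_mod_cast NeZero.ne p
  have h2 := Int.mul_ediv_add_emod x p
  rw [ZMod.val_intCast]
  rw [show k - x = (k - x % p) + p * (-(x / p)) by linarith, Int.add_mul_ediv_left _ _ hp]
  ring

lemma ediv_sub_one [NeZero p] {k : ℤ} (h : ¬ (p : ℤ) ∣ k) : (k - 1) / p = k / p := by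
  have hp : (0 : ℤ) < p := by exact_mod_cast Nat.pos_of_ne_zero (NeZero.ne p)
  have h1 := Int.mul_ediv_add_emod k p
  have h3 : 0 < k % p :=
    lt_of_le_of_ne (Int.emod_nonneg k hp.ne') fun h' => h (Int.dvd_of_emod_eq_zero h'.symm)
  have h5 := Int.emod_lt_of_pos k hp
  rw [Int.ediv_eq_iff_of_pos hp]
  constructor <;> linarith

lemma card_val_lt_le [NeZero p] (m : ℕ) : #{z : ZMod p | z.val < m} ≤ m := by
  calc #{z : ZMod p | z.val < m} ≤ #(range m) :=
        card_le_card_of_injOn ZMod.val (by intro z hz; simpa using hz)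
          (fun _ _ _ _ h => ZMod.val_injective p h)
    _ = m := card_range m

lemma card_zmod [NeZero p] : #(univ : Finset (ZMod p)) = p := by
  rw [card_univ, ZMod.card]

lemma card_triples_le [Fact p.Prime] (hp : p ≠ 2) (m m' : ℕ) (k : ZMod p) (K κ : ZMod p → ZMod p) :
    #{t : ZMod p × ZMod p × ZMod p | (t.2.2 - t.2.1 * t.1).val < m ∧
      (κ t.1 - t.2.2 - (K t.1 - t.2.1) * (k - t.1)).val < m'} ≤ p * (m * m') + p * p := by
  have h2 : (2 : ZMod p) ≠ 0 := by
    have := Fact.out (p := p.Prime)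
    intro h
    have h' : ((2 : ℕ) : ZMod p) = 0 := by exact_mod_cast h
    rw [ZMod.natCast_eq_zero_iff] at h'
    exact hp ((Nat.prime_dvd_prime_iff_eq this Nat.prime_two).1 h')
  rw [← card_filter_add_card_filter_not (fun t : ZMod p × ZMod p × ZMod p => k - 2 * t.1 ≠ 0)]
  gcongr
  · calc _ ≤ #((univ : Finset (ZMod p)) ×ˢ ({z : ZMod p | z.val < m} : Finset (ZMod p)) ×ˢ
              ({z : ZMod p | z.val < m'} : Finset (ZMod p))) := by
          refine card_le_card_of_injOn (fun t => (t.1, t.2.2 - t.2.1 * t.1,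
            κ t.1 - t.2.2 - (K t.1 - t.2.1) * (k - t.1))) ?_ ?_
          · intro t ht
            simp only [coe_filter, mem_filter, mem_univ, true_and, Set.mem_ofPred_eq] at ht
            simp [ht.1.1, ht.1.2]
          · rintro ⟨b, a, y⟩ ht ⟨b₂, a₂, y₂⟩ - h
            simp only [coe_filter, mem_filter, mem_univ, true_and, Set.mem_ofPred_eq] at ht
            simp only [Prod.mk.injEq] at h
            obtain ⟨rfl, h3, h4⟩ := h
            have h5 : (k - 2 * b) * (a - a₂) = 0 := by linear_combination h3 + h4
            have h6 : a = a₂ := by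
              rcases mul_eq_zero.1 h5 with h | h
              · exact absurd h ht.2
              · exact sub_eq_zero.1 h
            subst h6
            have h7 : y = y₂ := by linear_combination h3
            rw [h7]
    _ ≤ p * (m * m') := by
          rw [card_product, card_product, card_zmod]
          gcongr <;> exact card_val_lt_le _
  · calc _ ≤ #((univ : Finset (ZMod p)) ×ˢ (univ : Finset (ZMod p))) := by
          refine card_le_card_of_injOn (fun t => t.2) (by intro t _; simp) ?_
          rintro ⟨b, t⟩ ht ⟨b₂, t₂⟩ ht₂ h
          simp only [coe_filter, mem_filter, mem_univ, true_and, Set.mem_ofPred_eq, not_not] at ht ht₂ h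
          have h5 : 2 * (b - b₂) = 0 := by linear_combination ht₂.2 - ht.2
          have h6 := sub_eq_zero.1 ((mul_eq_zero.1 h5).resolve_left h2)
          rw [h, h6]
    _ = p * p := by rw [card_product, card_zmod]

/-- The integers `x ∈ [0, 8p⁴)` with base-`p` digits `b, a, y, d` (lowest first) and leading part
`i` such that `y - a * b` has a representative in `[0, m i)`. -/
noncomputable def parabolaSet (p : ℕ) (m : ℤ → ℕ) : Finset ℤ :=
  {x ∈ Finset.Ico (0 : ℤ) (8 * p ^ 4) |
    (((x / p / p : ℤ) : ZMod p) - ((x / p : ℤ) : ZMod p) * (x : ZMod p)).val < m (x / p / p / p / p)}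

lemma card_Ico_zero_eight : #(Ico (0 : ℤ) 8) = 8 := by decide

lemma ediv_mem_Ico [NeZero p] {n x : ℤ} (hx : x ∈ Finset.Ico 0 (p * n)) :
    x / p ∈ Finset.Ico 0 n := by
  have hp : (0 : ℤ) < p := by exact_mod_cast Nat.pos_of_ne_zero (NeZero.ne p)
  rw [Finset.mem_Ico] at hx ⊢
  exact ⟨Int.ediv_nonneg hx.1 hp.le, Int.ediv_lt_of_lt_mul hp (by linarith)⟩

lemma lead_mem_Ico [NeZero p] {x : ℤ} (hx : x ∈ Finset.Ico (0 : ℤ) (8 * p ^ 4)) :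
    x / p / p / p / p ∈ Finset.Ico (0 : ℤ) 8 := by
  refine ediv_mem_Ico (ediv_mem_Ico (ediv_mem_Ico (ediv_mem_Ico ?_)))
  convert hx using 2
  ring

lemma digits_injective [NeZero p] {x x' : ℤ} (hb : (x : ZMod p) = x')
    (ha : ((x / p : ℤ) : ZMod p) = (x' / p : ℤ))
    (hy : ((x / p / p : ℤ) : ZMod p) = (x' / p / p : ℤ))
    (hd : ((x / p / p / p : ℤ) : ZMod p) = (x' / p / p / p : ℤ))
    (hi : x / p / p / p / p = x' / p / p / p / p) : x = x' :=
  int_eq_of_zmod_eq_of_div_eq hb <| int_eq_of_zmod_eq_of_div_eq ha <|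
    int_eq_of_zmod_eq_of_div_eq hy <| int_eq_of_zmod_eq_of_div_eq hd hi

lemma ediv_mul_add_val [NeZero p] (X : ℤ) (z : ZMod p) : (X * p + z.val) / p = X := by
  have hp : (0 : ℤ) < p := by exact_mod_cast Nat.pos_of_ne_zero (NeZero.ne p)
  have := z.val_lt
  rw [Int.ediv_eq_iff_of_pos hp]
  constructor <;> nlinarith

lemma cast_mul_add_val [NeZero p] (X : ℤ) (z : ZMod p) : ((X * p + z.val : ℤ) : ZMod p) = z := by
  simp

lemma card_parabolaSet_ge [NeZero p] {m : ℤ → ℕ} (hm : ∀ i, m i ≤ p) :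
    ∑ i ∈ Ico (0 : ℤ) 8, m i * p ^ 3 ≤ #(parabolaSet p m) := by
  have hp : (0 : ℤ) < p := by exact_mod_cast Nat.pos_of_ne_zero (NeZero.ne p)
  rw [card_eq_sum_card_fiberwise (s := parabolaSet p m) (f := fun x : ℤ => x / p / p / p / p)
    (t := Ico (0 : ℤ) 8) fun x hx => lead_mem_Ico (mem_filter.1 hx).1]
  refine sum_le_sum fun i hi => ?_
  have hcard : #(range (m i) ×ˢ (univ : Finset (ZMod p)) ×ˢ (univ : Finset (ZMod p)) ×ˢ
      (univ : Finset (ZMod p))) = m i * p ^ 3 := by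
    simp only [card_product, card_zmod, card_range]
    ring
  rw [← hcard]
  refine card_le_card_of_injOn (fun t => ((((i * p + t.2.2.2.val) * p +
    ((t.1 : ZMod p) + t.2.1 * t.2.2.1).val) * p + t.2.1.val) * p + t.2.2.1.val : ℤ)) ?_ ?_
  · rintro ⟨u, a, b, d⟩ ht
    have hu : u < m i := by simpa using ht
    rw [mem_Ico] at hi
    simp only [coe_filter, Set.mem_ofPred_eq, parabolaSet, mem_filter, mem_Ico, ediv_mul_add_val,
      cast_mul_add_val, add_sub_cancel_right, and_true]
    refine ⟨⟨by have := hi.1; positivity, ?_⟩, ?_⟩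
    · have hlt : ∀ {X n : ℤ} (z : ZMod p), X < n → X * p + z.val < n * p := by
        intro X n z hX
        have := z.val_lt
        nlinarith
      calc _ < 8 * (p : ℤ) * p * p * p := hlt _ <| hlt _ <| hlt _ <| hlt _ hi.2
        _ = 8 * p ^ 4 := by ring
    · rwa [ZMod.val_cast_of_lt (hu.trans_le (hm i))]
  · rintro ⟨u, a, b, d⟩ ht ⟨u', a', b', d'⟩ ht' h
    have hu : u < m i := by simpa using ht
    have hu' : u' < m i := by simpa using ht'
    dsimp only at h
    have h1 := congrArg (· / (p : ℤ)) h
    have h2 := congrArg (· / (p : ℤ)) h1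
    have h3 := congrArg (· / (p : ℤ)) h2
    simp only [ediv_mul_add_val] at h1 h2 h3
    replace h := congrArg (Int.cast (R := ZMod p)) h
    replace h1 := congrArg (Int.cast (R := ZMod p)) h1
    replace h2 := congrArg (Int.cast (R := ZMod p)) h2
    replace h3 := congrArg (Int.cast (R := ZMod p)) h3
    simp only [cast_mul_add_val] at h h1 h2 h3
    subst h h1 h3
    have h4 := congrArg ZMod.val (add_right_cancel h2)
    rw [ZMod.val_cast_of_lt (hu.trans_le (hm i)), ZMod.val_cast_of_lt (hu'.trans_le (hm i))] at h4
    rw [h4]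

/-- The part of a sumset representation count of `parabolaSet` with prescribed leading parts. -/
lemma card_parabolaSet_fiber_le [Fact p.Prime] (hp : p ≠ 2) (m : ℤ → ℕ) (k : ℤ) {d : ZMod p}
    (hd : ((k / p / p / p : ℤ) : ZMod p) ≠ d) (i : ℤ) :
    #{x ∈ parabolaSet p m | k - x ∈ parabolaSet p m ∧ ((x / p / p / p : ℤ) : ZMod p) = d ∧
      x / p / p / p / p = i} ≤
      if m ((k / p / p / p - d.val) / p - i) = 0 then 0
      else p * (m i * (m ((k / p / p / p - d.val) / p - i) + 1)) + p * p := by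
  have hp0 : (0 : ℤ) < p := by exact_mod_cast (Fact.out : p.Prime).pos
  set j := (k / p / p / p - d.val) / p - i with hj
  have hlead : ∀ x : ℤ, ((x / p / p / p : ℤ) : ZMod p) = d → x / p / p / p / p = i →
      (k - x) / p / p / p / p = j := by
    rintro x rfl rfl
    have h3 : (k - x) / p / p / p = k / p / p / p - x / p / p / p ∨
        (k - x) / p / p / p = k / p / p / p - x / p / p / p - 1 := by
      have h := ediv_sub_cases (p * p * p) k x (by positivity)
      rwa [← Int.ediv_ediv_of_nonneg (by positivity), ← Int.ediv_ediv_of_nonneg (by positivity),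
        ← Int.ediv_ediv_of_nonneg (by positivity), ← Int.ediv_ediv_of_nonneg (by positivity),
        ← Int.ediv_ediv_of_nonneg (by positivity), ← Int.ediv_ediv_of_nonneg (by positivity)] at h
    rcases h3 with h3 | h3
    · rw [h3, ediv_sub_eq_val]
    · rw [h3, sub_right_comm, ediv_sub_eq_val, hj, sub_right_comm, ediv_sub_one]
      rw [← ZMod.intCast_zmod_eq_zero_iff_dvd]
      push_cast
      rw [ZMod.natCast_zmod_val]
      exact sub_ne_zero.2 hd
  split_ifs with h0
  · rw [Nat.le_zero, card_eq_zero, filter_eq_empty_iff]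
    rintro x - ⟨hx, hxd, hxi⟩
    have := (mem_filter.1 hx).2
    rw [hlead x hxd hxi, h0] at this
    exact absurd this (Nat.not_lt_zero _)
  refine le_trans ?_ (card_triples_le hp (m i) (m j + 1) (k : ZMod p)
    (fun b => (((k - b.val) / p : ℤ) : ZMod p)) fun b => (((k - b.val) / p / p : ℤ) : ZMod p))
  refine card_le_card_of_injOn (fun x : ℤ => ((x : ZMod p), ((x / p : ℤ) : ZMod p),
    ((x / p / p : ℤ) : ZMod p))) ?_ ?_
  · intro x hx
    simp only [coe_filter, Set.mem_ofPred_eq] at hx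
    obtain ⟨hx, hx', hxd, hxi⟩ := hx
    replace hx := (mem_filter.1 hx).2
    replace hx' := (mem_filter.1 hx').2
    rw [hxi] at hx
    rw [hlead x hxd hxi] at hx'
    simp only [coe_filter, Set.mem_ofPred_eq, mem_univ, true_and]
    refine ⟨hx, ?_⟩
    rw [ediv_sub_eq_val k x] at hx'
    rcases ediv_sub_cases p ((k - (x : ZMod p).val) / p) (x / p) hp0 with h | h
    · rw [h] at hx'
      push_cast at hx'
      exact hx'.trans (Nat.lt_succ_self _)
    · rw [h] at hx'
      push_cast at hx'
      have h1 := ZMod.val_add_le ((((k - (x : ZMod p).val) / p / p : ℤ) : ZMod p) -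
        ((x / p / p : ℤ) : ZMod p) - 1 - ((((k - (x : ZMod p).val) / p : ℤ) : ZMod p) -
        ((x / p : ℤ) : ZMod p)) * ((k : ZMod p) - (x : ZMod p))) 1
      have h2 : (1 : ZMod p).val ≤ 1 := by
        have : Fact (1 < p) := ⟨(Fact.out : p.Prime).one_lt⟩
        exact (ZMod.val_one p).le
      rw [sub_right_comm _ (1 : ZMod p), sub_add_cancel, sub_right_comm _ _ (1 : ZMod p)] at h1
      omega
  · intro x hx x' hx' h
    simp only [coe_filter, Set.mem_ofPred_eq] at hx hx'
    simp only [Prod.mk.injEq] at h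
    exact digits_injective h.1 h.2.1 h.2.2 (hx.2.2.1.trans hx'.2.2.1.symm)
      (hx.2.2.2.trans hx'.2.2.2.symm)

lemma card_parabolaSet_carry_le [NeZero p] (m : ℤ → ℕ) (q : ZMod p) :
    #{x ∈ parabolaSet p m | ((x / p / p / p : ℤ) : ZMod p) = q} ≤ 8 * p ^ 3 := by
  have hcard : #(Ico (0 : ℤ) 8 ×ˢ (univ : Finset (ZMod p)) ×ˢ (univ : Finset (ZMod p)) ×ˢ
      (univ : Finset (ZMod p))) = 8 * p ^ 3 := by
    simp only [card_product, card_zmod, card_Ico_zero_eight]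
    ring
  rw [← hcard]
  refine card_le_card_of_injOn (fun x : ℤ => (x / p / p / p / p, (x : ZMod p),
    ((x / p : ℤ) : ZMod p), ((x / p / p : ℤ) : ZMod p))) ?_ ?_
  · intro x hx
    have := lead_mem_Ico (mem_filter.1 (mem_filter.1 hx).1).1
    simp only [coe_product, Set.mem_prod, mem_coe, this, mem_univ, and_self]
  · intro x hx x' hx' h
    simp only [Prod.mk.injEq] at h
    exact digits_injective h.2.1 h.2.2.1 h.2.2.2
      ((mem_filter.1 hx).2.trans (mem_filter.1 hx').2.symm) h.1

lemma card_parabolaSet_rep_le [Fact p.Prime] (hp : p ≠ 2) {m : ℤ → ℕ} {B : ℕ}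
    (hB : ∀ l : ℤ, (∑ i ∈ Ico (0 : ℤ) 8,
      if m (l - i) = 0 then 0 else m i * (m (l - i) + 1)) ≤ B) (k : ℤ) :
    #{x ∈ parabolaSet p m | k - x ∈ parabolaSet p m} ≤ 8 * p ^ 3 + p * (p * B + 8 * (p * p)) := by
  rw [← card_filter_add_card_filter_not
    (fun x : ℤ => ((x / p / p / p : ℤ) : ZMod p) = ((k / p / p / p : ℤ) : ZMod p))]
  refine add_le_add ?_ ?_
  · refine le_trans (card_le_card ?_) (card_parabolaSet_carry_le m ((k / p / p / p : ℤ) : ZMod p))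
    exact filter_subset_filter _ (filter_subset _ _)
  · rw [card_eq_sum_card_fiberwise (f := fun x : ℤ => ((x / p / p / p : ℤ) : ZMod p)) (t := univ)
      fun x _ => mem_coe.2 (mem_univ _)]
    calc _ ≤ ∑ _d : ZMod p, (p * B + 8 * (p * p)) := ?_
      _ = _ := by rw [sum_const, card_zmod, smul_eq_mul]
    refine sum_le_sum fun d _ => ?_
    by_cases hd : ((k / p / p / p : ℤ) : ZMod p) = d
    · refine le_of_eq_of_le (card_eq_zero.2 ?_) (Nat.zero_le _)
      rw [filter_eq_empty_iff]
      intro x hx hxd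
      exact (mem_filter.1 hx).2 (hxd.trans hd.symm)
    rw [card_eq_sum_card_fiberwise (f := fun x : ℤ => x / p / p / p / p) (t := Ico (0 : ℤ) 8)
      fun x hx => lead_mem_Ico (by
        simp only [coe_filter, Set.mem_ofPred_eq, mem_filter, parabolaSet] at hx
        exact hx.1.1.1.1)]
    set l := (k / p / p / p - d.val) / p
    calc _ ≤ ∑ i ∈ Ico (0 : ℤ) 8,
            (p * (if m (l - i) = 0 then 0 else m i * (m (l - i) + 1)) + p * p) := by
          refine sum_le_sum fun i _ => ?_
          refine le_trans (card_le_card ?_) ((card_parabolaSet_fiber_le hp m k hd i).trans ?_)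
          · intro x hx
            simp only [mem_filter] at hx ⊢
            exact ⟨hx.1.1.1.1, hx.1.1.1.2, hx.1.2, hx.2⟩
          · simp only [l]
            split_ifs <;> simp only [mul_zero, zero_add, zero_le, le_refl]
      _ ≤ p * B + 8 * (p * p) := by
          rw [sum_add_distrib, ← mul_sum, sum_const, card_Ico_zero_eight]
          exact add_le_add (Nat.mul_le_mul_left _ (hB l)) le_rfl

/-- Step function on eight cells, in units of one half. -/
def stepWeight (i : ℤ) : ℕ :=
  if i = 0 ∨ i = 1 ∨ i = 2 ∨ i = 4 ∨ i = 7 then 2 else if i = 5 then 1 else 0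

lemma stepWeight_le (i : ℤ) : stepWeight i ≤ 2 := by
  unfold stepWeight; split_ifs <;> norm_num

lemma stepWeight_eq_zero {i : ℤ} (hi : i < 0 ∨ 7 < i) : stepWeight i = 0 := by
  unfold stepWeight
  rw [if_neg (by omega), if_neg (by omega)]

lemma sum_stepWeight : ∑ i ∈ Ico (0 : ℤ) 8, stepWeight i = 11 := by decide

lemma sum_stepWeight_mul_le (l : ℤ) :
    ∑ i ∈ Ico (0 : ℤ) 8, stepWeight i * stepWeight (l - i) ≤ 12 := by
  by_cases h : 0 ≤ l ∧ l ≤ 14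
  · obtain ⟨h0, h1⟩ := h
    interval_cases l <;> decide
  · refine le_of_eq_of_le (sum_eq_zero fun i hi => ?_) (Nat.zero_le 12)
    rw [mem_Ico] at hi
    rw [stepWeight_eq_zero (i := l - i) (by omega), mul_zero]

lemma sum_ceil_stepWeight_le (p : ℕ) {c : ℝ} (hc0 : 0 ≤ c) (hc1 : c ≤ 1) (l : ℤ) :
    ((∑ i ∈ Ico (0 : ℤ) 8, if ⌈c * p * stepWeight (l - i) / 2⌉₊ = 0 then 0 else
      ⌈c * p * stepWeight i / 2⌉₊ * (⌈c * p * stepWeight (l - i) / 2⌉₊ + 1) : ℕ) : ℝ) ≤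
      3 * (c * p) ^ 2 + 8 * (3 * p + 2) := by
  have hcp : c * p ≤ p := mul_le_of_le_one_left (Nat.cast_nonneg p) hc1
  have hcp0 : 0 ≤ c * p := by positivity
  have hle : ∀ i, c * p * stepWeight i / 2 ≤ p := by
    intro i
    have : (stepWeight i : ℝ) ≤ 2 := by exact_mod_cast stepWeight_le i
    nlinarith
  push_cast
  calc _ ≤ ∑ i ∈ Ico (0 : ℤ) 8,
        ((c * p) ^ 2 / 4 * (stepWeight i * stepWeight (l - i) : ℕ) + (3 * p + 2)) := by
        refine sum_le_sum fun i _ => ?_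
        split_ifs with h
        · positivity
        · have h1 := (Nat.ceil_lt_add_one (show 0 ≤ c * p * stepWeight i / 2 by positivity)).le
          have h2 := (Nat.ceil_lt_add_one
            (show 0 ≤ c * p * stepWeight (l - i) / 2 by positivity)).le
          have h3 := hle i
          have h4 := hle (l - i)
          push_cast
          calc _ ≤ (c * p * stepWeight i / 2 + 1) * (c * p * stepWeight (l - i) / 2 + 1 + 1) := by
                gcongr
            _ ≤ _ := by nlinarith
    _ = (c * p) ^ 2 / 4 * (∑ i ∈ Ico (0 : ℤ) 8, stepWeight i * stepWeight (l - i) : ℕ) +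
          8 * (3 * p + 2) := by
        rw [sum_add_distrib, ← mul_sum, Nat.cast_sum, sum_const, card_Ico_zero_eight,
          nsmul_eq_mul, Nat.cast_ofNat]
    _ ≤ (c * p) ^ 2 / 4 * 12 + 8 * (3 * p + 2) := by
        gcongr
        exact_mod_cast sum_stepWeight_mul_le l
    _ = _ := by ring

end Combinatorics

lemma Δ_le_add_div_prime {p : ℕ} [Fact p.Prime] (hp : p ≠ 2) {ε : ℝ} (hε0 : 0 < ε)
    (hε1 : ε ≤ 11 / 16) : Δ ε ≤ 96 / 121 * ε ^ 2 + 7 / p := by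
  have hp0 : 0 < p := (Fact.out : p.Prime).pos
  have hp1 : (1 : ℝ) ≤ p := by exact_mod_cast hp0
  set c : ℝ := 16 / 11 * ε with hc
  have hc0 : 0 ≤ c := by positivity
  have hc1 : c ≤ 1 := by linarith
  set m : ℤ → ℕ := fun i => ⌈c * p * stepWeight i / 2⌉₊ with hm
  have hmp : ∀ i, m i ≤ p := by
    intro i
    have : (stepWeight i : ℝ) ≤ 2 := by exact_mod_cast stepWeight_le i
    have : c * p ≤ p := mul_le_of_le_one_left (Nat.cast_nonneg p) hc1
    have : 0 ≤ c * p := by positivity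
    exact Nat.ceil_le.2 (by nlinarith)
  obtain ⟨B, hBle, hB⟩ : ∃ B : ℕ, (B : ℝ) ≤ 3 * (c * p) ^ 2 + 8 * (3 * p + 2) ∧
      ∀ l : ℤ, (∑ i ∈ Ico (0 : ℤ) 8,
        if m (l - i) = 0 then 0 else m i * (m (l - i) + 1)) ≤ B :=
    ⟨_, Nat.floor_le (by positivity), fun l => Nat.le_floor (sum_ceil_stepWeight_le p hc0 hc1 l)⟩
  have hcard : ε * ((8 * p ^ 4 : ℕ) : ℝ) ≤ #(parabolaSet p m) := by
    calc ε * ((8 * p ^ 4 : ℕ) : ℝ)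
        = c * p / 2 * ((∑ i ∈ Ico (0 : ℤ) 8, stepWeight i : ℕ) : ℝ) * p ^ 3 := by
          rw [sum_stepWeight, hc]; push_cast; ring
      _ = ∑ i ∈ Ico (0 : ℤ) 8, c * p * stepWeight i / 2 * p ^ 3 := by
          rw [Nat.cast_sum, mul_sum, sum_mul]
          exact sum_congr rfl fun i _ => by ring
      _ ≤ ∑ i ∈ Ico (0 : ℤ) 8, (m i : ℝ) * p ^ 3 := by
          gcongr with i
          exact Nat.le_ceil _
      _ ≤ #(parabolaSet p m) := by exact_mod_cast card_parabolaSet_ge hmp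
  have hrange : ∀ x ∈ parabolaSet p m, 0 ≤ x ∧ x < ((8 * p ^ 4 : ℕ) : ℤ) := fun x hx => by
    exact_mod_cast mem_Ico.1 (mem_filter.1 hx).1
  have hN : 0 < 8 * p ^ 4 := by positivity
  refine (Δ_le_of_finset hN hrange (card_parabolaSet_rep_le hp hB) hε0.le hcard).trans ?_
  · push_cast
    calc _ ≤ (8 * (p : ℝ) ^ 3 + p * (p * (3 * (c * p) ^ 2 + 8 * (3 * p + 2)) + 8 * (p * p))) /
          (8 * p ^ 4) := by gcongr
      _ = 96 / 121 * ε ^ 2 + (5 + 2 / p) / p := by rw [hc]; field_simp; ring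
      _ ≤ 96 / 121 * ε ^ 2 + 7 / p := by
        have : 2 / (p : ℝ) ≤ 2 := div_le_self zero_le_two hp1
        gcongr
        linarith

theorem delta_upper_96_121 (ε : ℝ) (hε0 : 0 < ε) (hε1 : ε ≤ 11/16) :
    Δ ε ≤ 96/121 * ε^2 := by
  refine le_of_forall_pos_le_add fun δ hδ => ?_
  obtain ⟨n, hn⟩ := exists_nat_gt (7 / δ)
  obtain ⟨p, hnp, hp⟩ := Nat.exists_infinite_primes (max n 3)
  have : Fact p.Prime := ⟨hp⟩
  have hp3 : 3 ≤ p := (le_max_right _ _).trans hnp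
  have hpn : (n : ℝ) ≤ p := by exact_mod_cast (le_max_left _ _).trans hnp
  refine (Δ_le_add_div_prime (p := p) (by omega) hε0 hε1).trans ?_
  gcongr
  rw [div_le_comm₀ (by positivity) hδ]
  linarith
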